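/- Let N : (ℤ^d×ℤ^d) × (ℤ^d×ℤ^d) → ℂ be a family of complex numbers for which there exists n ∈ ℕ with sup_{α̃,β̃} ⟨(α̃,β̃)⟩^{-n} · |N_{α̃,β̃}| < ∞. Then for every Schwartz function H ∈ 𝒮(ℝ^{2d};ℂ) the series Σ_{α̃,β̃} N_{α̃,β̃} · ∫_{ℝ^{2d}} G_{α̃,β̃}(x,y) H(x,y) dx dy converges absolutely, and the map sending H to this sum is a continuous linear functional on 𝒮(ℝ^{2d};ℂ), i.e. a tempered distribution on ℝ^{2d}. -/

import Mathlib

open MeasureTheory Filter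
open scoped ENNReal

noncomputable section

/-- Japanese bracket `⟨v⟩ = √(1+‖v‖²)` with the Euclidean norm on `ℝ^N`. -/
def jbV {N : ℕ} (v : Fin N → ℝ) : ℝ := Real.sqrt (1 + ∑ i, v i ^ 2)

/-- A tempered weight on `ℝ^N`: a positive function `m` with
`m(u+v) ≤ C·m(u)·⟨v⟩^a` for some `C, a > 0`. -/
def IsTemperedWeight {N : ℕ} (m : (Fin N → ℝ) → ℝ) : Prop :=
  (∀ u, 0 < m u) ∧ ∃ C > 0, ∃ a : ℝ, 0 < a ∧ ∀ u v, m (u + v) ≤ C * m u * jbV v ^ a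

/-- A regular magnetic field on `ℝ^d`: smooth, antisymmetric, closed, with all
derivatives of all components bounded. -/
structure IsRegularMagneticField (d : ℕ) (B : Fin d → Fin d → (Fin d → ℝ) → ℝ) : Prop where
  smooth : ∀ j k, ContDiff ℝ (⊤ : ℕ∞) (B j k)
  antisymm : ∀ j k x, B j k x = - B k j x
  closed : ∀ i j k, ∀ x : Fin d → ℝ,
      fderiv ℝ (B j k) x (Pi.single i 1) + fderiv ℝ (B k i) x (Pi.single j 1)
        + fderiv ℝ (B i j) x (Pi.single k 1) = 0
  derivBounded : ∀ j k, ∀ n : ℕ, ∃ C : ℝ, ∀ x, ‖iteratedFDeriv ℝ n (B j k) x‖ ≤ C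

/-- The transversal-gauge vector potential based at `y`:
`A_k(x;y) = Σ_j ∫₀¹ s·(x_j−y_j)·B_{jk}(y+s(x−y)) ds`. -/
def magA (d : ℕ) (B : Fin d → Fin d → (Fin d → ℝ) → ℝ) (y x : Fin d → ℝ) (k : Fin d) : ℝ :=
  ∑ j, ∫ s in (0:ℝ)..1, s * (x j - y j) * B j k (y + s • (x - y))

/-- The circulation `φ(x,y) = Σ_k ∫₀¹ A_k(y+s(x−y))·(x_k−y_k) ds` of `A = A(·;0)`
along the segment from `y` to `x`. -/
def magPhi (d : ℕ) (B : Fin d → Fin d → (Fin d → ℝ) → ℝ) (x y : Fin d → ℝ) : ℝ :=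
  ∑ k, ∫ s in (0:ℝ)..1, magA d B 0 (y + s • (x - y)) k * (x k - y k)

/-- A window function for the magnetic Gabor frame: smooth, compactly supported in
`(−1,1)^d`, with `Σ_{α∈ℤ^d} 𝔤(x−α)² = 1`. -/
structure IsWindow (d : ℕ) (g : (Fin d → ℝ) → ℝ) : Prop where
  smooth : ContDiff ℝ (⊤ : ℕ∞) g
  compactSupport : HasCompactSupport g
  support_subset : ∀ x : Fin d → ℝ, g x ≠ 0 → ∀ i, |x i| < 1
  partition : ∀ x : Fin d → ℝ, ∑' α : Fin d → ℤ, (g (x - fun i => (α i : ℝ))) ^ 2 = 1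

abbrev Idx (d : ℕ) := (Fin d → ℤ) × (Fin d → ℤ)
abbrev Idx2 (d : ℕ) := Idx d × Idx d
abbrev E1 (d : ℕ) := Fin d → ℝ
abbrev E2 (d : ℕ) := E1 d × E1 d
abbrev E4 (d : ℕ) := E2 d × E2 d

/-- The magnetic Gabor function
`𝒢_α̃(x) = (2π)^{−d/2}·e^{iφ(x,α)}·𝔤(x−α)·e^{iα'·(x−α)}` for `α̃ = (α,α')`. -/
def gabor (d : ℕ) (B : Fin d → Fin d → E1 d → ℝ) (g : E1 d → ℝ) (a : Idx d) (x : E1 d) : ℂ :=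
  (((2 * Real.pi) ^ (-(d : ℝ) / 2) : ℝ) : ℂ) *
    Complex.exp (Complex.I * (magPhi d B x (fun i => (a.1 i : ℝ)) : ℂ)) *
    ((g (x - fun i => (a.1 i : ℝ)) : ℝ) : ℂ) *
    Complex.exp (Complex.I * ((∑ i, (a.2 i : ℝ) * (x i - (a.1 i : ℝ)) : ℝ) : ℂ))

/-- `G_{α̃,β̃}(x,y) = 𝒢_α̃(x)·conj(𝒢_β̃(y))`. -/
def gaborTensor (d : ℕ) (B : Fin d → Fin d → E1 d → ℝ) (g : E1 d → ℝ) (a b : Idx d)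
    (p : E2 d) : ℂ :=
  gabor d B g a p.1 * (starRingEnd ℂ) (gabor d B g b p.2)

/-- `T_{α̃,β̃}(x,y) = conj(𝒢_α̃(x))·𝒢_β̃(y)`. -/
def gaborDual (d : ℕ) (B : Fin d → Fin d → E1 d → ℝ) (g : E1 d → ℝ) (a b : Idx d)
    (p : E2 d) : ℂ :=
  (starRingEnd ℂ) (gabor d B g a p.1) * gabor d B g b p.2

/-- The frame coefficient `c_{α̃,β̃}(F) = ∫ F(x,y)·conj(𝒢_α̃(x))·𝒢_β̃(y) dx dy`. -/
def frameCoef (d : ℕ) (B : Fin d → Fin d → E1 d → ℝ) (g : E1 d → ℝ) (a b : Idx d)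
    (F : E2 d → ℂ) : ℂ :=
  ∫ p : E2 d, F p * (starRingEnd ℂ) (gabor d B g a p.1) * gabor d B g b p.2

/-- `⟨(α̃,β̃)⟩` with `(α̃,β̃)` regarded as a point of `ℝ^{4d}`. -/
def jbIdxPair (d : ℕ) (a b : Idx d) : ℝ :=
  Real.sqrt (1 + (∑ i, ((a.1 i : ℝ)) ^ 2) + (∑ i, ((a.2 i : ℝ)) ^ 2)
    + (∑ i, ((b.1 i : ℝ)) ^ 2) + ∑ i, ((b.2 i : ℝ)) ^ 2)

/-- Euclidean Japanese bracket on `ℝ^{4d} = E4 d`. -/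
def jbE4 (d : ℕ) (v : E4 d) : ℝ :=
  Real.sqrt (1 + (∑ i, v.1.1 i ^ 2) + (∑ i, v.1.2 i ^ 2) + (∑ i, v.2.1 i ^ 2) + ∑ i, v.2.2 i ^ 2)

/-- A tempered weight on `ℝ^{4d}`. -/
def IsTemperedWeightE4 (d : ℕ) (M : E4 d → ℝ) : Prop :=
  (∀ u, 0 < M u) ∧ ∃ C > 0, ∃ a : ℝ, 0 < a ∧ ∀ u v, M (u + v) ≤ C * M u * jbE4 d v ^ a

/-- Euclidean Japanese bracket on `ℝ^N × ℝ^N`. -/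
def jbP {N : ℕ} (v : (Fin N → ℝ) × (Fin N → ℝ)) : ℝ :=
  Real.sqrt (1 + (∑ i, v.1 i ^ 2) + ∑ i, v.2 i ^ 2)

/-- A tempered weight on `ℝ^N × ℝ^N ≅ ℝ^{2N}`. -/
def IsTemperedWeightProd {N : ℕ} (m : (Fin N → ℝ) × (Fin N → ℝ) → ℝ) : Prop :=
  (∀ u, 0 < m u) ∧ ∃ C > 0, ∃ a : ℝ, 0 < a ∧ ∀ u v, m (u + v) ≤ C * m u * jbP v ^ a

/-- `⟨(α̃,β̃) − (γ̃,δ̃)⟩` for pairs of indices in `ℤ^{2d} × ℤ^{2d}`. -/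
def jbDiffIdx2 (d : ℕ) (p q : Idx2 d) : ℝ :=
  Real.sqrt (1 + (∑ i, ((p.1.1 i - q.1.1 i : ℤ) : ℝ) ^ 2) + (∑ i, ((p.1.2 i - q.1.2 i : ℤ) : ℝ) ^ 2)
    + (∑ i, ((p.2.1 i - q.2.1 i : ℤ) : ℝ) ^ 2) + ∑ i, ((p.2.2 i - q.2.2 i : ℤ) : ℝ) ^ 2)

/-- The midpoint `((α̃,β̃)+(γ̃,δ̃))/2 ∈ ℝ^{4d}`. -/
def midIdx2 (d : ℕ) (p q : Idx2 d) : E4 d :=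
  ((fun i => ((p.1.1 i + q.1.1 i : ℤ) : ℝ) / 2, fun i => ((p.1.2 i + q.1.2 i : ℤ) : ℝ) / 2),
   (fun i => ((p.2.1 i + q.2.1 i : ℤ) : ℝ) / 2, fun i => ((p.2.2 i + q.2.2 i : ℤ) : ℝ) / 2))

/-- Membership in the Hörmander class `S₀(M)` on `ℝ^{4d}`: smooth, with all
derivatives dominated by `M`. -/
def InS0 (d : ℕ) (M : E4 d → ℝ) (Φ : E4 d → ℂ) : Prop :=
  ContDiff ℝ (⊤ : ℕ∞) Φ ∧ ∀ n : ℕ, ∃ C : ℝ, ∀ X, ‖iteratedFDeriv ℝ n Φ X‖ ≤ C * M X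

/-- The seminorms `‖Φ‖_{S₀(M),k}`. -/
def s0Seminorm (d : ℕ) (M : E4 d → ℝ) (k : ℕ) (Φ : E4 d → ℂ) : ℝ :=
  ∑ n ∈ Finset.range (k + 1), ⨆ X : E4 d, ‖iteratedFDeriv ℝ n Φ X‖ / M X

/-- The integrand of the inner (oscillatory) integral defining `H_{(α̃,β̃),(γ̃,δ̃)}`,
evaluated at `X = ((v_L,ξ_L),(v_R,ξ_R))` and `z = (z_L,z_R)`. -/
def gaborKernel4 (d : ℕ) (B : Fin d → Fin d → E1 d → ℝ) (g : E1 d → ℝ) (ab gd : Idx2 d)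
    (X : E4 d) (z : E2 d) : ℂ :=
  Complex.exp (Complex.I * (((∑ i, X.1.2 i * z.1 i) - ∑ i, X.2.2 i * z.2 i : ℝ) : ℂ)) *
  Complex.exp (Complex.I * ((magPhi d B (X.1.1 + (2 : ℝ)⁻¹ • z.1) (X.1.1 - (2 : ℝ)⁻¹ • z.1)
      - magPhi d B (X.2.1 + (2 : ℝ)⁻¹ • z.2) (X.2.1 - (2 : ℝ)⁻¹ • z.2) : ℝ) : ℂ)) *
  gabor d B g gd.1 (X.1.1 + (2 : ℝ)⁻¹ • z.1) *
  (starRingEnd ℂ) (gabor d B g gd.2 (X.2.1 + (2 : ℝ)⁻¹ • z.2)) *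
  (starRingEnd ℂ) (gabor d B g ab.1 (X.1.1 - (2 : ℝ)⁻¹ • z.1)) *
  gabor d B g ab.2 (X.2.1 - (2 : ℝ)⁻¹ • z.2)

/-- The kernel `H_{(α̃,β̃),(γ̃,δ̃)}` on `ℝ^{4d}`. -/
def matH (d : ℕ) (B : Fin d → Fin d → E1 d → ℝ) (g : E1 d → ℝ) (ab gd : Idx2 d)
    (X : E4 d) : ℂ :=
  (((2 * Real.pi) ^ (-(2 * (d : ℝ))) : ℝ) : ℂ) * ∫ z : E2 d, gaborKernel4 d B g ab gd X z

/-- The matrix element `𝕄_{(α̃,β̃),(γ̃,δ̃)}[Φ] = ∫ Φ·H_{(α̃,β̃),(γ̃,δ̃)}`. -/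
def matElem (d : ℕ) (B : Fin d → Fin d → E1 d → ℝ) (g : E1 d → ℝ) (Φ : E4 d → ℂ)
    (ab gd : Idx2 d) : ℂ :=
  ∫ X : E4 d, Φ X * matH d B g ab gd X

/-- The dequantized frame symbol
`g_{α̃,γ̃}(v,ξ) = ∫ e^{−iξ·z}·e^{−iφ(v+z/2,v−z/2)}·𝒢_α̃(v+z/2)·conj(𝒢_γ̃(v−z/2)) dz`. -/
def deqSymbol (d : ℕ) (B : Fin d → Fin d → E1 d → ℝ) (g : E1 d → ℝ) (ac : Idx d × Idx d)
    (vξ : E2 d) : ℂ :=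
  ∫ z : E1 d,
    Complex.exp (-Complex.I * ((∑ i, vξ.2 i * z i : ℝ) : ℂ)) *
    Complex.exp (-Complex.I * ((magPhi d B (vξ.1 + (2 : ℝ)⁻¹ • z) (vξ.1 - (2 : ℝ)⁻¹ • z) : ℝ) : ℂ)) *
    gabor d B g ac.1 (vξ.1 + (2 : ℝ)⁻¹ • z) *
    (starRingEnd ℂ) (gabor d B g ac.2 (vξ.1 - (2 : ℝ)⁻¹ • z))

section TemperateGrowth

open Function

variable {D E F G : Type} [NormedAddCommGroup D] [NormedSpace ℝ D] [NormedAddCommGroup E]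
  [NormedSpace ℝ E] [NormedAddCommGroup F] [NormedSpace ℝ F] [NormedAddCommGroup G]
  [NormedSpace ℝ G]

lemma hasTemperateGrowth_fderiv {f : E → F} (hf : HasTemperateGrowth f) :
    HasTemperateGrowth (fderiv ℝ f) := by
  refine ⟨hf.1.fderiv_right (by simp), fun n => ?_⟩
  obtain ⟨k, C, h⟩ := hf.2 (n + 1)
  exact ⟨k, C, fun x => by rw [norm_iteratedFDeriv_fderiv]; exact h x⟩

lemma hasTemperateGrowth_prodMk {f : D → E} {g : D → F} (hf : HasTemperateGrowth f)
    (hg : HasTemperateGrowth g) : HasTemperateGrowth fun x => (f x, g x) := by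
  have h := ((ContinuousLinearMap.inl ℝ E F).hasTemperateGrowth.comp hf).add
    ((ContinuousLinearMap.inr ℝ E F).hasTemperateGrowth.comp hg)
  convert h using 1
  ext x <;> simp

lemma hasTemperateGrowth_comp {g : E → F} {f : D → E} (hg : HasTemperateGrowth g)
    (hf : HasTemperateGrowth f) : HasTemperateGrowth fun x => g (f x) :=
  hg.comp hf

lemma hasTemperateGrowth_fst : HasTemperateGrowth fun p : E × F => p.1 :=
  (ContinuousLinearMap.fst ℝ E F).hasTemperateGrowth

lemma hasTemperateGrowth_snd : HasTemperateGrowth fun p : E × F => p.2 :=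
  (ContinuousLinearMap.snd ℝ E F).hasTemperateGrowth

lemma hasTemperateGrowth_eval {ι : Type} [Fintype ι] (i : ι) :
    HasTemperateGrowth fun x : ι → ℝ => x i :=
  (ContinuousLinearMap.proj (R := ℝ) (φ := fun _ : ι => ℝ) i).hasTemperateGrowth

lemma hasTemperateGrowth_cexp_I_mul :
    HasTemperateGrowth fun t : ℝ => Complex.exp (Complex.I * (t : ℂ)) := by
  have hs : ContDiff ℝ (⊤ : ℕ∞) fun t : ℝ => Complex.exp (Complex.I * (t : ℂ)) :=
    (contDiff_const.mul Complex.ofRealCLM.contDiff).cexp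
  have hd : ∀ c : ℂ, deriv (fun t : ℝ => c * Complex.exp (Complex.I * (t : ℂ))) =
      fun t : ℝ => (c * Complex.I) * Complex.exp (Complex.I * (t : ℂ)) := by
    intro c
    ext t
    have h := ((((Complex.ofRealCLM.hasDerivAt (x := t)).const_mul Complex.I).cexp).const_mul c)
    simp only [Complex.ofRealCLM_apply] at h
    rw [h.deriv]
    simp
    ring
  have hb : ∀ (n : ℕ) (c : ℂ) (t : ℝ),
      ‖iteratedDeriv n (fun t : ℝ => c * Complex.exp (Complex.I * (t : ℂ))) t‖ = ‖c‖ := by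
    intro n
    induction n with
    | zero =>
      intro c t
      simp [mul_comm Complex.I, Complex.norm_exp_ofReal_mul_I]
    | succ n ih =>
      intro c t
      rw [iteratedDeriv_succ', hd, ih]
      simp
  refine ⟨hs, fun n => ⟨0, 1, fun t => ?_⟩⟩
  rw [norm_iteratedFDeriv_eq_norm_iteratedDeriv]
  have := hb n 1 t
  simp only [one_mul] at this
  simp [this]

lemma exists_nonneg_bound_of_hasTemperateGrowth {f : E → F} (hf : HasTemperateGrowth f) :
    ∃ (k : ℕ) (C : ℝ), 0 ≤ C ∧ ∀ x, ‖f x‖ ≤ C * (1 + ‖x‖) ^ k := by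
  obtain ⟨k, C, hC, h⟩ := hf.norm_iteratedFDeriv_le_uniform 0
  exact ⟨k, C, hC, fun x => by simpa using h 0 le_rfl x⟩

lemma exists_bound_of_hasTemperateGrowth_prod {f : E × ℝ → F} (hf : HasTemperateGrowth f) :
    ∃ (k : ℕ) (C : ℝ), 0 ≤ C ∧
      ∀ x, ∀ s ∈ Set.uIoc (0 : ℝ) 1, ‖f (x, s)‖ ≤ C * (1 + ‖x‖) ^ k := by
  obtain ⟨k, C, hC, h⟩ := exists_nonneg_bound_of_hasTemperateGrowth hf
  refine ⟨k, C * 2 ^ k, by positivity, fun x s hs => (h (x, s)).trans ?_⟩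
  rw [Set.uIoc_of_le zero_le_one] at hs
  rw [mul_assoc, ← mul_pow]
  have h1 : ‖(x, s)‖ ≤ ‖x‖ + 1 := by
    rw [Prod.norm_mk]
    refine max_le (by linarith) ?_
    rw [Real.norm_of_nonneg hs.1.le]
    linarith [hs.2, norm_nonneg x]
  gcongr
  linarith [norm_nonneg x]

lemma norm_intervalIntegral_le_of_hasTemperateGrowth {f : E × ℝ → F} (hf : HasTemperateGrowth f) :
    ∃ (k : ℕ) (C : ℝ), ∀ x, ‖∫ s in (0 : ℝ)..1, f (x, s)‖ ≤ C * (1 + ‖x‖) ^ k := by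
  obtain ⟨k, C, -, h⟩ := exists_bound_of_hasTemperateGrowth_prod hf
  refine ⟨k, C, fun x => ?_⟩
  simpa using intervalIntegral.norm_integral_le_of_norm_le_const (h x)

lemma hasFDerivAt_intervalIntegral_of_hasTemperateGrowth {f : E × ℝ → F}
    (hf : HasTemperateGrowth f) (x₀ : E) :
    HasFDerivAt (fun x => ∫ s in (0 : ℝ)..1, f (x, s))
      (∫ s in (0 : ℝ)..1, (fderiv ℝ f (x₀, s)).comp (ContinuousLinearMap.inl ℝ E ℝ)) x₀ := by
  have hg : HasTemperateGrowth
      fun p : E × ℝ => (fderiv ℝ f p).comp (ContinuousLinearMap.inl ℝ E ℝ) :=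
    ((ContinuousLinearMap.compL ℝ E (E × ℝ) F).flip
      (ContinuousLinearMap.inl ℝ E ℝ)).hasTemperateGrowth.comp (hasTemperateGrowth_fderiv hf)
  obtain ⟨k, C, hC, h⟩ := exists_bound_of_hasTemperateGrowth_prod hg
  have hfc := hf.1.continuous
  have hgc := hg.1.continuous
  refine intervalIntegral.hasFDerivAt_integral_of_dominated_of_fderiv_le
    (bound := fun _ => C * (1 + (‖x₀‖ + 1)) ^ k)
    (F' := fun x s => (fderiv ℝ f (x, s)).comp (ContinuousLinearMap.inl ℝ E ℝ))
    (Metric.ball_mem_nhds x₀ one_pos) ?_ ?_ ?_ ?_ ?_ ?_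
  · exact Eventually.of_forall fun x =>
      (hfc.comp (by fun_prop : Continuous fun s : ℝ => (x, s))).aestronglyMeasurable
  · exact (hfc.comp (by fun_prop : Continuous fun s : ℝ => (x₀, s))).intervalIntegrable _ _
  · exact (hgc.comp (by fun_prop : Continuous fun s : ℝ => (x₀, s))).aestronglyMeasurable
  · refine Eventually.of_forall fun s hs x hx => (h x s hs).trans ?_
    have : ‖x‖ ≤ ‖x₀‖ + 1 := by
      have := norm_le_norm_add_norm_sub' x x₀
      rw [Metric.mem_ball, dist_eq_norm] at hx
      linarith
    gcongr
  · exact intervalIntegrable_const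
  · refine Eventually.of_forall fun s _ x _ => ?_
    exact ((hf.1.differentiable (by simp)) (x, s)).hasFDerivAt.comp x
      (hasFDerivAt_prodMk_left x s)

lemma hasTemperateGrowth_intervalIntegral {f : E × ℝ → F} (hf : HasTemperateGrowth f) :
    HasTemperateGrowth fun x => ∫ s in (0 : ℝ)..1, f (x, s) := by
  have key : ∀ (n : ℕ) (F : Type) [NormedAddCommGroup F] [NormedSpace ℝ F] (f : E × ℝ → F),
      HasTemperateGrowth f → ContDiff ℝ n (fun x => ∫ s in (0 : ℝ)..1, f (x, s)) ∧
        ∃ (k : ℕ) (C : ℝ), ∀ x,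
          ‖iteratedFDeriv ℝ n (fun x => ∫ s in (0 : ℝ)..1, f (x, s)) x‖ ≤ C * (1 + ‖x‖) ^ k := by
    intro n
    induction n with
    | zero =>
      intro F _ _ f hf
      refine ⟨?_, ?_⟩
      · exact contDiff_zero.2 (continuous_iff_continuousAt.2 fun x =>
          (hasFDerivAt_intervalIntegral_of_hasTemperateGrowth hf x).continuousAt)
      · simpa using norm_intervalIntegral_le_of_hasTemperateGrowth hf
    | succ n ih =>
      intro F _ _ f hf
      have hd := hasFDerivAt_intervalIntegral_of_hasTemperateGrowth hf
      have hg : HasTemperateGrowth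
          fun p : E × ℝ => (fderiv ℝ f p).comp (ContinuousLinearMap.inl ℝ E ℝ) :=
        ((ContinuousLinearMap.compL ℝ E (E × ℝ) F).flip
          (ContinuousLinearMap.inl ℝ E ℝ)).hasTemperateGrowth.comp (hasTemperateGrowth_fderiv hf)
      have he : fderiv ℝ (fun x => ∫ s in (0 : ℝ)..1, f (x, s)) = fun x =>
          ∫ s in (0 : ℝ)..1, (fderiv ℝ f (x, s)).comp (ContinuousLinearMap.inl ℝ E ℝ) :=
        funext fun x => (hd x).fderiv
      obtain ⟨h1, k, C, h2⟩ := ih _ _ hg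
      refine ⟨?_, k, C, fun x => ?_⟩
      · push_cast
        refine contDiff_succ_iff_fderiv.2 ⟨fun x => (hd x).differentiableAt, by simp, ?_⟩
        rw [he]
        exact h1
      · rw [← norm_iteratedFDeriv_fderiv, he]
        exact h2 x
  exact ⟨contDiff_infty.2 fun n => (key n F f hf).1, fun n => (key n F f hf).2⟩

end TemperateGrowth

section Oscillatory

open Function

variable {V : Type} [NormedAddCommGroup V] [NormedSpace ℝ V]

/-- Kernels `K(x,a)` of temperate growth supported in a uniform neighbourhood `‖x - a‖ ≤ R` of the
diagonal. -/
def IsTemperateNearDiagonal (K : V × V → ℂ) : Prop :=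
  HasTemperateGrowth K ∧ ∃ R : ℝ, 0 ≤ R ∧ ∀ x a, R < ‖x - a‖ → K (x, a) = 0

lemma IsTemperateNearDiagonal.fderiv_apply_left {K : V × V → ℂ} (hK : IsTemperateNearDiagonal K)
    (v : V) : IsTemperateNearDiagonal fun p => fderiv ℝ K p (v, 0) := by
  obtain ⟨h, R, hR, hs⟩ := hK
  refine ⟨(ContinuousLinearMap.apply ℝ ℂ ((v, 0) : V × V)).hasTemperateGrowth.comp
    (hasTemperateGrowth_fderiv h), R, hR, fun x a hxa => ?_⟩
  have hU : IsOpen {p : V × V | R < ‖p.1 - p.2‖} :=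
    isOpen_lt continuous_const (by fun_prop)
  have he : K =ᶠ[nhds (x, a)] fun _ => 0 := by
    filter_upwards [hU.mem_nhds (show (x, a) ∈ {p : V × V | R < ‖p.1 - p.2‖} from hxa)] with p hp
    exact hs p.1 p.2 hp
  simp [he.fderiv_eq]

/-- The plane wave of frequency `ξ`. -/
def planeWave (ξ : V →L[ℝ] ℝ) (x : V) : ℂ := Complex.exp (Complex.I * (ξ x : ℂ))

lemma norm_planeWave (ξ : V →L[ℝ] ℝ) (x : V) : ‖planeWave ξ x‖ = 1 := by
  rw [planeWave, mul_comm, Complex.norm_exp_ofReal_mul_I]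

lemma hasFDerivAt_planeWave (ξ : V →L[ℝ] ℝ) (x : V) :
    HasFDerivAt (planeWave ξ)
      ((planeWave ξ x * Complex.I) • (Complex.ofRealCLM.comp ξ)) x := by
  have h := ((Complex.ofRealCLM.comp ξ).hasFDerivAt (x := x)).const_mul Complex.I |>.cexp
  rw [smul_smul] at h
  exact h

lemma continuous_planeWave (ξ : V →L[ℝ] ℝ) : Continuous (planeWave ξ) :=
  continuous_iff_continuousAt.2 fun x => (hasFDerivAt_planeWave ξ x).continuousAt

variable [FiniteDimensional ℝ V] [MeasureSpace V] [BorelSpace V]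
  [(volume : Measure V).IsAddHaarMeasure]

lemma IsTemperateNearDiagonal.exists_seminorm_bound {K : V × V → ℂ}
    (hK : IsTemperateNearDiagonal K) (k : ℕ) :
    ∃ p : Seminorm ℝ (SchwartzMap V ℂ), Continuous p ∧
      ∀ (a : V) (ξ : V →L[ℝ] ℝ) (H : SchwartzMap V ℂ),
        (1 + ‖a‖) ^ k * ‖∫ x, planeWave ξ x * K (x, a) * H x‖ ≤ p H := by
  obtain ⟨h, R, hR, hs⟩ := hK
  obtain ⟨M, C, hC, hb⟩ := exists_nonneg_bound_of_hasTemperateGrowth h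
  set r := (volume : Measure V).integrablePower
  set J : ℝ := ∫ x : V, (1 + ‖x‖) ^ (-(r : ℝ))
  have hJ0 : 0 ≤ J := integral_nonneg fun x => by positivity
  set m : ℕ × ℕ := (k + M + M + r, 0) with hm
  set q : Seminorm ℝ (SchwartzMap V ℂ) :=
    (Finset.Iic m).sup (schwartzSeminormFamily ℝ V ℂ)
  have hqc : Continuous q :=
    Seminorm.continuous_finsetSup fun i _ =>
      (schwartz_withSeminorms ℝ V ℂ).continuous_seminorm i
  set c : ℝ := C * (1 + R) ^ (k + M) * 2 ^ m.1 * J with hc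
  have hc0 : 0 ≤ c := by positivity
  have hval : ∀ H, (c.toNNReal • q) H = c * q H := fun H => by
    rw [smul_apply, NNReal.smul_def, Real.coe_toNNReal c hc0, smul_eq_mul]
  refine ⟨c.toNNReal • q, ?_, fun a ξ H => ?_⟩
  · exact (continuous_const.mul hqc : Continuous fun H => c * q H).congr fun H => (hval H).symm
  rw [hval]
  have hH : ∀ x, (1 + ‖x‖) ^ m.1 * ‖H x‖ ≤ 2 ^ m.1 * q H := fun x => by
    have := SchwartzMap.one_add_le_sup_seminorm_apply (𝕜 := ℝ) (m := m) (n := 0) le_rfl le_rfl H x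
    rwa [norm_iteratedFDeriv_zero] at this
  have hpt : ∀ x, ‖(((1 + ‖a‖) ^ k : ℝ) : ℂ) * (planeWave ξ x * K (x, a) * H x)‖ ≤
      (C * (1 + R) ^ (k + M) * 2 ^ m.1 * q H) * (1 + ‖x‖) ^ (-(r : ℝ)) := by
    intro x
    rw [norm_mul, norm_mul, norm_mul, norm_planeWave, one_mul, Complex.norm_real,
      Real.norm_of_nonneg (by positivity)]
    by_cases hxa : R < ‖x - a‖
    · rw [hs x a hxa]
      simp only [norm_zero, zero_mul, mul_zero]
      positivity
    have ha : 1 + ‖a‖ ≤ (1 + R) * (1 + ‖x‖) := by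
      have := norm_le_norm_add_norm_sub' a x
      rw [norm_sub_rev] at this
      nlinarith [norm_nonneg x, mul_nonneg hR (norm_nonneg x)]
    have hxa' : 1 + ‖(x, a)‖ ≤ (1 + ‖x‖) * (1 + ‖a‖) := by
      rw [Prod.norm_mk]
      have : max ‖x‖ ‖a‖ ≤ ‖x‖ + ‖a‖ := max_le (by simp) (by simp)
      nlinarith [mul_nonneg (norm_nonneg x) (norm_nonneg a)]
    have hx0 : 0 < 1 + ‖x‖ := by positivity
    have h1 : (1 + ‖a‖) ^ k * (‖K (x, a)‖ * ‖H x‖) ≤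
        C * (1 + R) ^ (k + M) * (1 + ‖x‖) ^ (k + M + M) * ‖H x‖ := by
      calc (1 + ‖a‖) ^ k * (‖K (x, a)‖ * ‖H x‖)
          ≤ (1 + ‖a‖) ^ k * (C * ((1 + ‖x‖) * (1 + ‖a‖)) ^ M * ‖H x‖) := by
            gcongr
            exact (hb (x, a)).trans (by gcongr)
        _ = C * (1 + ‖x‖) ^ M * (1 + ‖a‖) ^ (k + M) * ‖H x‖ := by
            rw [mul_pow, pow_add]; ring
        _ ≤ C * (1 + ‖x‖) ^ M * ((1 + R) * (1 + ‖x‖)) ^ (k + M) * ‖H x‖ := by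
            gcongr
        _ = _ := by rw [mul_pow, pow_add _ (k + M) M]; ring
    refine h1.trans ?_
    rw [Real.rpow_neg hx0.le, Real.rpow_natCast, ← div_eq_mul_inv, le_div_iff₀ (by positivity)]
    calc C * (1 + R) ^ (k + M) * (1 + ‖x‖) ^ (k + M + M) * ‖H x‖ * (1 + ‖x‖) ^ r
        = C * (1 + R) ^ (k + M) * ((1 + ‖x‖) ^ m.1 * ‖H x‖) := by
          rw [hm, pow_add _ (k + M + M) r]; ring
      _ ≤ C * (1 + R) ^ (k + M) * (2 ^ m.1 * q H) :=
          mul_le_mul_of_nonneg_left (hH x) (by positivity)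
      _ = _ := by ring
  have hint := norm_integral_le_of_norm_le
    (((volume : Measure V).integrable_pow_neg_integrablePower).const_mul _)
    (Eventually.of_forall hpt)
  rw [integral_const_mul, integral_const_mul, norm_mul, Complex.norm_real,
    Real.norm_of_nonneg (by positivity)] at hint
  refine hint.trans (le_of_eq ?_)
  rw [hc]; ring

lemma IsTemperateNearDiagonal.integrable {K : V × V → ℂ} (hK : IsTemperateNearDiagonal K)
    (a : V) (ξ : V →L[ℝ] ℝ) (H : SchwartzMap V ℂ) :
    Integrable fun x => planeWave ξ x * K (x, a) * H x := by
  obtain ⟨h, R, -, hs⟩ := hK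
  have hcs : HasCompactSupport fun x => planeWave ξ x * K (x, a) := by
    refine HasCompactSupport.intro (isCompact_closedBall a R) fun x hx => ?_
    rw [Metric.mem_closedBall, dist_eq_norm, not_le] at hx
    simp [hs x a hx]
  refine Continuous.integrable_of_hasCompactSupport ?_ hcs.mul_right
  have := h.1.continuous
  have := H.continuous
  have := continuous_planeWave ξ
  fun_prop

lemma IsTemperateNearDiagonal.integral_by_parts {K : V × V → ℂ}
    (hK : IsTemperateNearDiagonal K) (a v : V) (ξ : V →L[ℝ] ℝ) (H : SchwartzMap V ℂ) :
    (Complex.I * (ξ v : ℂ)) * ∫ x, planeWave ξ x * K (x, a) * H x =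
      -(∫ x, planeWave ξ x * fderiv ℝ K (x, a) (v, 0) * H x) -
        ∫ x, planeWave ξ x * K (x, a) * LineDeriv.lineDerivOpCLM ℝ (SchwartzMap V ℂ) v H x := by
  have hK' := hK.fderiv_apply_left v
  have hd : ∀ x, HasFDerivAt (fun x => planeWave ξ x * K (x, a)) _ x := fun x =>
    (hasFDerivAt_planeWave ξ x).mul
      (((hK.1.1.differentiable (by simp)) (x, a)).hasFDerivAt.comp x (hasFDerivAt_prodMk_left x a))
  have hd' : ∀ x, fderiv ℝ (fun x => planeWave ξ x * K (x, a)) x v =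
      (Complex.I * (ξ v : ℂ)) * (planeWave ξ x * K (x, a)) +
        planeWave ξ x * fderiv ℝ K (x, a) (v, 0) := by
    intro x
    rw [(hd x).fderiv]
    simp
    ring
  have hlin : ∀ x, LineDeriv.lineDerivOpCLM ℝ (SchwartzMap V ℂ) v H x = fderiv ℝ H x v := fun x =>
    SchwartzMap.lineDerivOp_apply_eq_fderiv v H x
  have hsplit : (fun x => fderiv ℝ (fun x => planeWave ξ x * K (x, a)) x v * H x) = fun x =>
      (Complex.I * (ξ v : ℂ)) * (planeWave ξ x * K (x, a) * H x) +
        planeWave ξ x * fderiv ℝ K (x, a) (v, 0) * H x := by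
    ext x
    rw [hd']
    ring
  have hip := integral_mul_fderiv_eq_neg_fderiv_mul_of_integrable (μ := (volume : Measure V))
    (f := fun x => planeWave ξ x * K (x, a)) (g := H) (v := v)
    (by rw [hsplit]; exact ((hK.integrable a ξ H).const_mul _).add (hK'.integrable a ξ H))
    (by
      simpa only [hlin] using hK.integrable a ξ (LineDeriv.lineDerivOpCLM ℝ (SchwartzMap V ℂ) v H))
    (hK.integrable a ξ H) (fun x _ => (hd x).differentiableAt) (fun x _ => H.differentiableAt)
  rw [hsplit, integral_add ((hK.integrable a ξ H).const_mul _) (hK'.integrable a ξ H),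
    integral_const_mul] at hip
  simp only [hlin]
  rw [hip]
  ring

lemma IsTemperateNearDiagonal.exists_seminorm_bound_frequency {ι : Type} [Fintype ι] (b : ι → V)
    (k m : ℕ) : ∀ {K : V × V → ℂ}, IsTemperateNearDiagonal K →
    ∃ p : Seminorm ℝ (SchwartzMap V ℂ), Continuous p ∧
      ∀ (a : V) (ξ : V →L[ℝ] ℝ) (H : SchwartzMap V ℂ),
        (1 + ‖a‖) ^ k * (1 + ∑ i, |ξ (b i)|) ^ m *
          ‖∫ x, planeWave ξ x * K (x, a) * H x‖ ≤ p H := by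
  induction m with
  | zero =>
    intro K hK
    simpa using hK.exists_seminorm_bound k
  | succ m ih =>
    intro K hK
    obtain ⟨p, hp, hpb⟩ := ih hK
    choose p' hp' hpb' using fun i => ih (hK.fderiv_apply_left (b i))
    let D := fun i => LineDeriv.lineDerivOpCLM ℝ (SchwartzMap V ℂ) (b i)
    have hval : ∀ H, (p + ∑ i, (p' i + p.comp (D i).toLinearMap)) H =
        p H + ∑ i, (p' i H + p (D i H)) := fun H => by
      rw [add_apply]
      congr 1
      simp
    refine ⟨p + ∑ i, (p' i + p.comp (D i).toLinearMap), ?_, fun a ξ H => ?_⟩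
    · have : Continuous fun H => p H + ∑ i, (p' i H + p (D i H)) :=
        hp.add (continuous_finsetSum _ fun i _ => (hp' i).add (hp.comp (D i).continuous))
      exact this.congr fun H => (hval H).symm
    rw [hval]
    set w : ℝ := (1 + ‖a‖) ^ k * (1 + ∑ i, |ξ (b i)|) ^ m with hw
    have hw0 : 0 ≤ w := by positivity
    have hi : ∀ i, w * (|ξ (b i)| * ‖∫ x, planeWave ξ x * K (x, a) * H x‖) ≤
        p' i H + p (D i H) := by
      intro i
      have h := congrArg norm (hK.integral_by_parts a (b i) ξ H)
      rw [norm_mul, norm_mul, Complex.norm_I, one_mul, Complex.norm_real, Real.norm_eq_abs] at h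
      rw [h]
      calc _ ≤ w * (‖∫ x, planeWave ξ x * fderiv ℝ K (x, a) (b i, 0) * H x‖ +
            ‖∫ x, planeWave ξ x * K (x, a) * D i H x‖) := by
            gcongr
            exact (norm_sub_le _ _).trans (by rw [norm_neg])
        _ ≤ _ := by
            rw [mul_add]
            exact add_le_add (hpb' i a ξ H) (hpb a ξ _)
    calc (1 + ‖a‖) ^ k * (1 + ∑ i, |ξ (b i)|) ^ (m + 1) *
          ‖∫ x, planeWave ξ x * K (x, a) * H x‖
        = w * ‖∫ x, planeWave ξ x * K (x, a) * H x‖ +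
          ∑ i, w * (|ξ (b i)| * ‖∫ x, planeWave ξ x * K (x, a) * H x‖) := by
          rw [← Finset.mul_sum, ← Finset.sum_mul, hw]
          ring
      _ ≤ _ := add_le_add (hpb a ξ H) (Finset.sum_le_sum fun i _ => hi i)

end Oscillatory

section MagneticPhase

open Function

lemma IsRegularMagneticField.hasTemperateGrowth {d : ℕ} {B : Fin d → Fin d → (Fin d → ℝ) → ℝ}
    (hB : IsRegularMagneticField d B) (j k : Fin d) : HasTemperateGrowth (B j k) :=
  ⟨hB.smooth j k, fun n => by
    obtain ⟨C, hC⟩ := hB.derivBounded j k n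
    exact ⟨0, C, by simpa using hC⟩⟩

lemma hasTemperateGrowth_magA {d : ℕ} {B : Fin d → Fin d → (Fin d → ℝ) → ℝ}
    (hB : IsRegularMagneticField d B) (k : Fin d) :
    HasTemperateGrowth fun x => magA d B 0 x k := by
  unfold magA
  refine HasTemperateGrowth.sum fun j _ => ?_
  refine hasTemperateGrowth_intervalIntegral
    (f := fun p : (Fin d → ℝ) × ℝ => p.2 * (p.1 j - (0 : Fin d → ℝ) j) *
      B j k (0 + p.2 • (p.1 - 0))) ?_
  have h1 : HasTemperateGrowth fun p : (Fin d → ℝ) × ℝ => p.1 := hasTemperateGrowth_fst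
  have h2 : HasTemperateGrowth fun p : (Fin d → ℝ) × ℝ => p.2 := hasTemperateGrowth_snd
  have h3 := hasTemperateGrowth_comp (hasTemperateGrowth_eval j) h1
  refine (h2.fun_mul (h3.fun_sub (.const _))).fun_mul (hasTemperateGrowth_comp
    (hB.hasTemperateGrowth j k) ((HasTemperateGrowth.const 0).fun_add
      (h2.fun_smul (h1.fun_sub (.const 0)))))

lemma hasTemperateGrowth_magPhi {d : ℕ} {B : Fin d → Fin d → (Fin d → ℝ) → ℝ}
    (hB : IsRegularMagneticField d B) :
    HasTemperateGrowth fun p : (Fin d → ℝ) × (Fin d → ℝ) => magPhi d B p.1 p.2 := by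
  unfold magPhi
  refine HasTemperateGrowth.sum fun k _ => ?_
  refine hasTemperateGrowth_intervalIntegral
    (f := fun p : ((Fin d → ℝ) × (Fin d → ℝ)) × ℝ =>
      magA d B 0 (p.1.2 + p.2 • (p.1.1 - p.1.2)) k * (p.1.1 k - p.1.2 k)) ?_
  have h1 : HasTemperateGrowth fun p : ((Fin d → ℝ) × (Fin d → ℝ)) × ℝ => p.1.1 :=
    hasTemperateGrowth_comp hasTemperateGrowth_fst hasTemperateGrowth_fst
  have h2 : HasTemperateGrowth fun p : ((Fin d → ℝ) × (Fin d → ℝ)) × ℝ => p.1.2 :=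
    hasTemperateGrowth_comp hasTemperateGrowth_snd hasTemperateGrowth_fst
  have h3 : HasTemperateGrowth fun p : ((Fin d → ℝ) × (Fin d → ℝ)) × ℝ => p.2 :=
    hasTemperateGrowth_snd
  exact (hasTemperateGrowth_comp (hasTemperateGrowth_magA hB k)
    (h2.fun_add (h3.fun_smul (h1.fun_sub h2)))).fun_mul
      ((hasTemperateGrowth_comp (hasTemperateGrowth_eval k) h1).fun_sub
        (hasTemperateGrowth_comp (hasTemperateGrowth_eval k) h2))

/-- The Gabor function at position `p.1` with real centre `p.2`, without its plane wave. -/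
def gaborEnvelope (d : ℕ) (B : Fin d → Fin d → E1 d → ℝ) (g : E1 d → ℝ) (p : E2 d) : ℂ :=
  (((2 * Real.pi) ^ (-(d : ℝ) / 2) : ℝ) : ℂ) *
    Complex.exp (Complex.I * (magPhi d B p.1 p.2 : ℂ)) * ((g (p.1 - p.2) : ℝ) : ℂ)

lemma hasTemperateGrowth_gaborEnvelope {d : ℕ} {B : Fin d → Fin d → E1 d → ℝ} {g : E1 d → ℝ}
    (hB : IsRegularMagneticField d B) (hg : IsWindow d g) :
    HasTemperateGrowth (gaborEnvelope d B g) :=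
  ((HasTemperateGrowth.const _).fun_mul (hasTemperateGrowth_comp hasTemperateGrowth_cexp_I_mul
    (hasTemperateGrowth_magPhi hB))).fun_mul
      (hasTemperateGrowth_comp Complex.ofRealCLM.hasTemperateGrowth
        (hasTemperateGrowth_comp (hg.compactSupport.hasTemperateGrowth hg.smooth)
          (hasTemperateGrowth_fst.fun_sub hasTemperateGrowth_snd)))

lemma gaborEnvelope_eq_zero {d : ℕ} {B : Fin d → Fin d → E1 d → ℝ} {g : E1 d → ℝ}
    (hg : IsWindow d g) {x a : E1 d} (h : 1 < ‖x - a‖) : gaborEnvelope d B g (x, a) = 0 := by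
  have : g (x - a) = 0 := by
    by_contra hne
    refine absurd h (not_lt.2 ((pi_norm_le_iff_of_nonneg zero_le_one).2 fun i => ?_))
    exact (hg.support_subset _ hne i).le
  simp [gaborEnvelope, this]

/-- The kernel of `gaborTensor` without its plane wave, as a function of the position `p.1` and the
real centre `p.2`. -/
def gaborTensorEnvelope (d : ℕ) (B : Fin d → Fin d → E1 d → ℝ) (g : E1 d → ℝ)
    (p : E2 d × E2 d) : ℂ :=
  gaborEnvelope d B g (p.1.1, p.2.1) * (starRingEnd ℂ) (gaborEnvelope d B g (p.1.2, p.2.2))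

lemma isTemperateNearDiagonal_gaborTensorEnvelope {d : ℕ} {B : Fin d → Fin d → E1 d → ℝ}
    {g : E1 d → ℝ} (hB : IsRegularMagneticField d B) (hg : IsWindow d g) :
    IsTemperateNearDiagonal (gaborTensorEnvelope d B g) := by
  refine ⟨?_, 1, zero_le_one, ?_⟩
  · have h1 : HasTemperateGrowth fun p : E2 d × E2 d => (p.1.1, p.2.1) :=
      hasTemperateGrowth_prodMk (hasTemperateGrowth_comp hasTemperateGrowth_fst
        hasTemperateGrowth_fst) (hasTemperateGrowth_comp hasTemperateGrowth_fst
        hasTemperateGrowth_snd)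
    have h2 : HasTemperateGrowth fun p : E2 d × E2 d => (p.1.2, p.2.2) :=
      hasTemperateGrowth_prodMk (hasTemperateGrowth_comp hasTemperateGrowth_snd
        hasTemperateGrowth_fst) (hasTemperateGrowth_comp hasTemperateGrowth_snd
        hasTemperateGrowth_snd)
    have h := hasTemperateGrowth_gaborEnvelope hB hg
    exact (hasTemperateGrowth_comp h h1).fun_mul
      (hasTemperateGrowth_comp Complex.conjCLE.toContinuousLinearMap.hasTemperateGrowth
        (hasTemperateGrowth_comp h h2))
  · intro x a hxa
    rw [Prod.norm_def, lt_max_iff] at hxa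
    rcases hxa with h | h
    · simp [gaborTensorEnvelope, gaborEnvelope_eq_zero hg (show 1 < ‖x.1 - a.1‖ from h)]
    · simp [gaborTensorEnvelope, gaborEnvelope_eq_zero hg (show 1 < ‖x.2 - a.2‖ from h)]

/-- The spatial centre `(α,β)` of an index pair. -/
def idxCentre (d : ℕ) (q : Idx2 d) : E2 d := (fun i => (q.1.1 i : ℝ), fun i => (q.2.1 i : ℝ))

/-- The frequency `(x,y) ↦ α'·x - β'·y` of an index pair. -/
def idxFrequency (d : ℕ) (q : Idx2 d) : E2 d →L[ℝ] ℝ :=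
  (∑ i, (q.1.2 i : ℝ) • ContinuousLinearMap.proj (R := ℝ) (φ := fun _ : Fin d => ℝ) i).comp
      (ContinuousLinearMap.fst ℝ (E1 d) (E1 d)) -
    (∑ i, (q.2.2 i : ℝ) • ContinuousLinearMap.proj (R := ℝ) (φ := fun _ : Fin d => ℝ) i).comp
      (ContinuousLinearMap.snd ℝ (E1 d) (E1 d))

lemma idxFrequency_apply (d : ℕ) (q : Idx2 d) (p : E2 d) :
    idxFrequency d q p = ∑ i, (q.1.2 i : ℝ) * p.1 i - ∑ i, (q.2.2 i : ℝ) * p.2 i := by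
  simp [idxFrequency]

/-- The standard basis of `ℝ^d × ℝ^d`. -/
def stdBasisE2 (d : ℕ) : Fin d ⊕ Fin d → E2 d :=
  Sum.elim (fun i => (Pi.single i 1, 0)) fun i => (0, Pi.single i 1)

lemma sum_abs_idxFrequency_stdBasisE2 (d : ℕ) (q : Idx2 d) :
    ∑ i, |idxFrequency d q (stdBasisE2 d i)| = ∑ i, |(q.1.2 i : ℝ)| + ∑ i, |(q.2.2 i : ℝ)| := by
  simp [Fintype.sum_sum_type, stdBasisE2, idxFrequency_apply, Pi.single_apply]

lemma gaborTensor_mul_eq (d : ℕ) (B : Fin d → Fin d → E1 d → ℝ) (g : E1 d → ℝ) (q : Idx2 d)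
    (p : E2 d) (z : ℂ) :
    gaborTensor d B g q.1 q.2 p * z = planeWave (-idxFrequency d q) (idxCentre d q) *
      (planeWave (idxFrequency d q) p * gaborTensorEnvelope d B g (p, idxCentre d q) * z) := by
  have hexp : Complex.exp (Complex.I *
        ((∑ i, (q.1.2 i : ℝ) * (p.1 i - (q.1.1 i : ℝ)) : ℝ) : ℂ)) *
      (starRingEnd ℂ) (Complex.exp (Complex.I *
        ((∑ i, (q.2.2 i : ℝ) * (p.2 i - (q.2.1 i : ℝ)) : ℝ) : ℂ))) =
      planeWave (-idxFrequency d q) (idxCentre d q) * planeWave (idxFrequency d q) p := by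
    rw [← Complex.exp_conj, planeWave, planeWave, ← Complex.exp_add, ← Complex.exp_add,
      map_mul, Complex.conj_I, Complex.conj_ofReal, neg_apply,
      idxFrequency_apply, idxFrequency_apply, idxCentre]
    congr 1
    simp only [mul_sub, Finset.sum_sub_distrib]
    push_cast
    ring
  rw [gaborTensor, gabor, gabor, map_mul]
  change (gaborEnvelope d B g (p.1, _) * _) * ((starRingEnd ℂ) (gaborEnvelope d B g (p.2, _)) * _) *
    z = _
  rw [mul_mul_mul_comm, hexp]
  simp only [gaborTensorEnvelope, idxCentre]
  ring

end MagneticPhase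

section Summability

lemma summable_prod_apply {f : ℤ → ℝ} (hf0 : ∀ n, 0 ≤ f n) (hf : Summable f) (d : ℕ) :
    Summable fun n : Fin d → ℤ => ∏ i, f (n i) := by
  induction d with
  | zero => exact Summable.of_finite
  | succ d ih =>
    rw [← (Fin.consEquiv fun _ => ℤ).summable_iff]
    have h := hf.mul_of_nonneg ih hf0 fun n => Finset.prod_nonneg fun i _ => hf0 _
    refine h.congr fun p => ?_
    simp [Fin.consEquiv, Fin.prod_univ_succ]

lemma summable_inv_one_add_abs_sq : Summable fun n : ℤ => ((1 + |(n : ℝ)|) ^ 2)⁻¹ := by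
  have h : Summable fun n : ℕ => ((1 + |(n : ℝ)|) ^ 2)⁻¹ := by
    have := (summable_nat_add_iff 1).2 (Real.summable_nat_pow_inv.2 one_lt_two)
    refine this.congr fun n => ?_
    rw [abs_of_nonneg (Nat.cast_nonneg n)]
    push_cast
    ring
  exact Summable.of_nat_of_neg (by simpa using h) (by simpa using h)

/-- The weight `(1 + ‖(α,β)‖)(1 + ∑ |α'ᵢ| + ∑ |β'ᵢ|)` of an index pair. -/
def idxWeight (d : ℕ) (q : Idx2 d) : ℝ :=
  (1 + ‖idxCentre d q‖) * (1 + ∑ i, |idxFrequency d q (stdBasisE2 d i)|)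

lemma one_le_idxWeight (d : ℕ) (q : Idx2 d) : 1 ≤ idxWeight d q :=
  one_le_mul_of_one_le_of_one_le (by simp) (le_add_of_nonneg_right (by positivity))

lemma one_add_norm_idxCentre_le (d : ℕ) (q : Idx2 d) : 1 + ‖idxCentre d q‖ ≤ idxWeight d q :=
  le_mul_of_one_le_right (by positivity) (le_add_of_nonneg_right (by positivity))

lemma one_add_sum_le_idxWeight (d : ℕ) (q : Idx2 d) :
    1 + (∑ i, |(q.1.2 i : ℝ)| + ∑ i, |(q.2.2 i : ℝ)|) ≤ idxWeight d q := by
  rw [← sum_abs_idxFrequency_stdBasisE2]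
  exact le_mul_of_one_le_left (by positivity) (by simp)

lemma abs_le_norm_idxCentre (d : ℕ) (q : Idx2 d) (i : Fin d) :
    |(q.1.1 i : ℝ)| ≤ ‖idxCentre d q‖ ∧ |(q.2.1 i : ℝ)| ≤ ‖idxCentre d q‖ :=
  ⟨(norm_le_pi_norm (idxCentre d q).1 i).trans (norm_fst_le _),
    (norm_le_pi_norm (idxCentre d q).2 i).trans (norm_snd_le _)⟩

lemma summable_inv_idxWeight_pow (d : ℕ) :
    Summable fun q : Idx2 d => (idxWeight d q ^ (2 * d + 2 * d + (2 * d + 2 * d)))⁻¹ := by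
  set f : ℤ → ℝ := fun n => ((1 + |(n : ℝ)|) ^ 2)⁻¹ with hf
  have hf0 : ∀ n, 0 ≤ f n := fun n => by positivity
  have h1 := summable_prod_apply hf0 summable_inv_one_add_abs_sq d
  have h10 : ∀ n : Fin d → ℤ, 0 ≤ ∏ i, f (n i) := fun n => Finset.prod_nonneg fun i _ => hf0 _
  have h2 := h1.mul_of_nonneg h1 h10 h10
  have h20 : ∀ n : Idx d, 0 ≤ (∏ i, f (n.1 i)) * ∏ i, f (n.2 i) := fun n =>
    mul_nonneg (h10 _) (h10 _)
  refine (h2.mul_of_nonneg h2 h20 h20).of_nonneg_of_le (fun q => ?_) fun q => ?_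
  · have := one_le_idxWeight d q
    positivity
  have hw := one_le_idxWeight d q
  have hp : ∀ n : Fin d → ℤ, (∀ i, 1 + |(n i : ℝ)| ≤ idxWeight d q) →
      (idxWeight d q ^ (2 * d))⁻¹ ≤ ∏ i, f (n i) := by
    intro n hn
    have : (idxWeight d q ^ (2 * d))⁻¹ = ∏ _i : Fin d, (idxWeight d q ^ 2)⁻¹ := by
      simp [pow_mul]
    rw [this]
    refine Finset.prod_le_prod (fun i _ => by positivity) fun i _ => ?_
    have := hn i
    simp only [hf]
    gcongr
  have hA := one_add_norm_idxCentre_le d q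
  have hX := one_add_sum_le_idxWeight d q
  have hs : ∀ (n : Fin d → ℤ) (i : Fin d), |(n i : ℝ)| ≤ ∑ i, |(n i : ℝ)| := fun n i =>
    Finset.single_le_sum (f := fun i => |(n i : ℝ)|) (fun i _ => abs_nonneg _) (Finset.mem_univ i)
  have hs0 : ∀ n : Fin d → ℤ, 0 ≤ ∑ i, |(n i : ℝ)| := fun n =>
    Finset.sum_nonneg fun i _ => abs_nonneg _
  have e1 := hp q.1.1 fun i => by linarith [(abs_le_norm_idxCentre d q i).1]
  have e2 := hp q.1.2 fun i => by linarith [hs q.1.2 i, hs0 q.2.2]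
  have e3 := hp q.2.1 fun i => by linarith [(abs_le_norm_idxCentre d q i).2]
  have e4 := hp q.2.2 fun i => by linarith [hs q.2.2 i, hs0 q.1.2]
  simp only [pow_add, mul_inv]
  have hz : 0 ≤ (idxWeight d q ^ (2 * d))⁻¹ := by positivity
  exact mul_le_mul (mul_le_mul e1 e2 hz (h10 _)) (mul_le_mul e3 e4 hz (h10 _)) (by positivity)
    (h20 _)

lemma jbIdxPair_le_idxWeight (d : ℕ) (q : Idx2 d) :
    jbIdxPair d q.1 q.2 ≤ (1 + 2 * d) * idxWeight d q := by
  have hs0 : ∀ n : Fin d → ℤ, 0 ≤ ∑ i, |(n i : ℝ)| := fun n =>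
    Finset.sum_nonneg fun i _ => abs_nonneg _
  have hsq : ∀ n : Fin d → ℤ, ∑ i, (n i : ℝ) ^ 2 ≤ (∑ i, |(n i : ℝ)|) ^ 2 := fun n => by
    simpa using Finset.sum_sq_le_sq_sum_of_nonneg (s := Finset.univ)
      (f := fun i => |(n i : ℝ)|) fun i _ => abs_nonneg _
  have hd : ∀ n : Fin d → ℤ, (∀ i, |(n i : ℝ)| ≤ ‖idxCentre d q‖) →
      ∑ i, |(n i : ℝ)| ≤ d * ‖idxCentre d q‖ := fun n hn => by
    simpa using Finset.sum_le_card_nsmul Finset.univ _ _ fun i _ => hn i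
  have h1 := hd q.1.1 fun i => (abs_le_norm_idxCentre d q i).1
  have h2 := hd q.2.1 fun i => (abs_le_norm_idxCentre d q i).2
  have hA := one_add_norm_idxCentre_le d q
  have hX := one_add_sum_le_idxWeight d q
  have hle : jbIdxPair d q.1 q.2 ≤ 1 + (∑ i, |(q.1.1 i : ℝ)|) + (∑ i, |(q.1.2 i : ℝ)|) +
      (∑ i, |(q.2.1 i : ℝ)|) + ∑ i, |(q.2.2 i : ℝ)| := by
    have a1 := hs0 q.1.1
    have a2 := hs0 q.1.2
    have a3 := hs0 q.2.1
    have a4 := hs0 q.2.2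
    rw [jbIdxPair]
    refine Real.sqrt_le_iff.2 ⟨by positivity, ?_⟩
    have := hsq q.1.1
    have := hsq q.1.2
    have := hsq q.2.1
    have := hsq q.2.2
    nlinarith [mul_nonneg a1 a2, mul_nonneg a1 a3, mul_nonneg a1 a4, mul_nonneg a2 a3,
      mul_nonneg a2 a4, mul_nonneg a3 a4]
  have : (d : ℝ) * ‖idxCentre d q‖ ≤ d * idxWeight d q := by
    gcongr
    linarith
  linarith

end Summability

section Pairing

instance isAddHaarMeasure_volume_E2 (d : ℕ) : (volume : Measure (E2 d)).IsAddHaarMeasure :=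
  Measure.prod.instIsAddHaarMeasure (volume : Measure (E1 d)) (volume : Measure (E1 d))

variable {d : ℕ} {B : Fin d → Fin d → (Fin d → ℝ) → ℝ} {g : (Fin d → ℝ) → ℝ}

lemma integrable_gaborTensor_mul (hB : IsRegularMagneticField d B) (hg : IsWindow d g)
    (q : Idx2 d) (H : SchwartzMap (E2 d) ℂ) :
    Integrable fun p : E2 d => gaborTensor d B g q.1 q.2 p * H p := by
  simp only [gaborTensor_mul_eq]
  exact ((isTemperateNearDiagonal_gaborTensorEnvelope hB hg).integrable _ _ H).const_mul _

lemma exists_seminorm_bound_integral_gaborTensor_mul (hB : IsRegularMagneticField d B)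
    (hg : IsWindow d g) (m : ℕ) :
    ∃ s : Seminorm ℝ (SchwartzMap (E2 d) ℂ), Continuous s ∧
      ∀ (q : Idx2 d) (H : SchwartzMap (E2 d) ℂ),
        idxWeight d q ^ m * ‖∫ p : E2 d, gaborTensor d B g q.1 q.2 p * H p‖ ≤ s H := by
  obtain ⟨s, hs, hsb⟩ :=
    (isTemperateNearDiagonal_gaborTensorEnvelope hB hg).exists_seminorm_bound_frequency
      (stdBasisE2 d) m m
  refine ⟨s, hs, fun q H => ?_⟩
  simp only [gaborTensor_mul_eq]
  rw [integral_const_mul, norm_mul, norm_planeWave, one_mul, idxWeight, mul_pow]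
  exact hsb _ _ H

lemma exists_seminorm_bound_coefficient_mul (hB : IsRegularMagneticField d B) (hg : IsWindow d g)
    {N : Idx2 d → ℂ} (hN : ∃ (n : ℕ) (C : ℝ), ∀ q : Idx2 d, ‖N q‖ ≤ C * jbIdxPair d q.1 q.2 ^ n)
    (m : ℕ) :
    ∃ s : Seminorm ℝ (SchwartzMap (E2 d) ℂ), Continuous s ∧ ∃ c : ℝ,
      ∀ (q : Idx2 d) (H : SchwartzMap (E2 d) ℂ),
        ‖N q * ∫ p : E2 d, gaborTensor d B g q.1 q.2 p * H p‖ ≤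
          c * s H * (idxWeight d q ^ m)⁻¹ := by
  obtain ⟨n, C, hN⟩ := hN
  obtain ⟨s, hs, hsb⟩ := exists_seminorm_bound_integral_gaborTensor_mul hB hg (n + m)
  refine ⟨s, hs, |C| * (1 + 2 * d) ^ n, fun q H => ?_⟩
  have hw : 0 < idxWeight d q := zero_lt_one.trans_le (one_le_idxWeight d q)
  have hNq : ‖N q‖ ≤ |C| * ((1 + 2 * d) * idxWeight d q) ^ n := by
    refine (hN q).trans (mul_le_mul (le_abs_self C) ?_ (pow_nonneg (Real.sqrt_nonneg _) _)
      (abs_nonneg C))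
    exact pow_le_pow_left₀ (Real.sqrt_nonneg _) (jbIdxPair_le_idxWeight d q) n
  rw [norm_mul, ← div_eq_mul_inv, le_div_iff₀ (by positivity)]
  set z := ‖∫ p : E2 d, gaborTensor d B g q.1 q.2 p * H p‖
  calc ‖N q‖ * z * idxWeight d q ^ m
      ≤ |C| * ((1 + 2 * d) * idxWeight d q) ^ n * z * idxWeight d q ^ m := by gcongr
    _ = |C| * (1 + 2 * d) ^ n * (idxWeight d q ^ (n + m) * z) := by rw [mul_pow]; ring
    _ ≤ |C| * (1 + 2 * d) ^ n * s H := by gcongr; exact hsb q H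

end Pairing

/-- polynomially bounded coefficients define a tempered distribution
through the frame, with absolutely convergent pairings against Schwartz functions. -/
theorem statement11 (d : ℕ) (hd : 0 < d) (B : Fin d → Fin d → (Fin d → ℝ) → ℝ)
    (hB : IsRegularMagneticField d B) (g : (Fin d → ℝ) → ℝ) (hg : IsWindow d g)
    (N : Idx2 d → ℂ)
    (hN : ∃ (n : ℕ) (C : ℝ), ∀ q : Idx2 d, ‖N q‖ ≤ C * jbIdxPair d q.1 q.2 ^ n) :
    (∀ H : SchwartzMap (E2 d) ℂ, Summable fun q : Idx2 d =>
        ‖N q * ∫ p : E2 d, gaborTensor d B g q.1 q.2 p * H p‖) ∧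
    ∃ u : SchwartzMap (E2 d) ℂ →L[ℂ] ℂ, ∀ H : SchwartzMap (E2 d) ℂ,
        u H = ∑' q : Idx2 d, N q * ∫ p : E2 d, gaborTensor d B g q.1 q.2 p * H p := by
  obtain ⟨s, hs, c, hc⟩ :=
    exists_seminorm_bound_coefficient_mul hB hg hN (2 * d + 2 * d + (2 * d + 2 * d))
  have hw := summable_inv_idxWeight_pow d
  have hsum : ∀ H : SchwartzMap (E2 d) ℂ, Summable fun q : Idx2 d =>
      ‖N q * ∫ p : E2 d, gaborTensor d B g q.1 q.2 p * H p‖ := fun H =>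
    (hw.mul_left (c * s H)).of_nonneg_of_le (fun q => norm_nonneg _) fun q => hc q H
  refine ⟨hsum, ?_⟩
  let u : SchwartzMap (E2 d) ℂ →ₗ[ℂ] ℂ :=
    { toFun := fun H => ∑' q : Idx2 d, N q * ∫ p : E2 d, gaborTensor d B g q.1 q.2 p * H p
      map_add' := fun H₁ H₂ => by
        rw [← (hsum H₁).of_norm.tsum_add (hsum H₂).of_norm]
        refine tsum_congr fun q => ?_
        rw [← mul_add, ← integral_add (integrable_gaborTensor_mul hB hg q H₁)
          (integrable_gaborTensor_mul hB hg q H₂)]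
        simp only [add_apply, mul_add]
      map_smul' := fun z H => by
        rw [RingHom.id_apply, smul_eq_mul, ← tsum_mul_left]
        refine tsum_congr fun q => ?_
        rw [mul_left_comm, ← integral_const_mul z]
        simp only [smul_apply, smul_eq_mul, mul_left_comm] }
  have hu : ∀ H, ‖u H‖ ≤ c * s H * ∑' q : Idx2 d,
      (idxWeight d q ^ (2 * d + 2 * d + (2 * d + 2 * d)))⁻¹ := fun H => by
    rw [← tsum_mul_left]
    exact (norm_tsum_le_tsum_norm (hsum H)).trans
      ((hsum H).tsum_le_tsum (fun q => hc q H) (hw.mul_left _))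
  have hcont : Continuous u := by
    refine continuous_of_continuousAt_zero u ?_
    rw [ContinuousAt, map_zero]
    refine squeeze_zero_norm hu ?_
    have h := ((hs.const_mul c).mul_const (∑' q : Idx2 d,
      (idxWeight d q ^ (2 * d + 2 * d + (2 * d + 2 * d)))⁻¹)).tendsto 0
    simpa using h
  exact ⟨⟨u, hcont⟩, fun H => rfl⟩
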